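/- arXiv:1611.04742 — 3 statements merged into one kernel-verified Lean document; each statement's English description precedes it below -/
import Mathlib

section
/- Let A be a unital C*-algebra, let Φ : A → A be a positive unital linear map, and let a ∈ A be a normal element (a*a = aa*). Then Φ(a) = a and Φ(a*a) = a*a if and only if Φ(b) = b for every b ∈ C*(1,a). -/
open Filter Topology in
/-- In a C⋆-algebra, if `n • p + q` is nonnegative for all positive `n`, then so is `p`. -/
lemma CStarAlgebra.nonneg_of_forall_smul_add_nonneg {A : Type*} [CStarAlgebra A] [PartialOrder A]
    [StarOrderedRing A] {p q : A} (h : ∀ n : ℕ, 0 < n → 0 ≤ (n : ℝ) • p + q) : 0 ≤ p := by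
  have hlim : Tendsto (fun n : ℕ ↦ p + (1 / ((n : ℝ) + 1)) • q) atTop (𝓝 p) := by
    simpa using tendsto_const_nhds.add
      ((tendsto_one_div_add_atTop_nhds_zero_nat (𝕜 := ℝ)).smul_const q)
  refine ge_of_tendsto' hlim fun n ↦ ?_
  have hn : (0 : ℝ) < n + 1 := by positivity
  have := smul_nonneg (one_div_pos.2 hn).le (h (n + 1) n.succ_pos)
  rwa [smul_add, smul_smul, Nat.cast_succ, one_div_mul_cancel hn.ne', one_smul] at this

/-- Bernstein polynomials take nonnegative values at elements between `0` and `1`. -/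
lemma CStarAlgebra.aeval_bernsteinPolynomial_nonneg {A : Type*} [CStarAlgebra A] [PartialOrder A]
    [StarOrderedRing A] {x : A} (h0 : 0 ≤ x) (h1 : x ≤ 1) (n ν : ℕ) :
    0 ≤ Polynomial.aeval x (bernsteinPolynomial ℝ n ν) := by
  have hc : Commute x (1 - x) := (Commute.one_right x).sub_right (Commute.refl x)
  have hpow {y : A} (hy : 0 ≤ y) (m : ℕ) : 0 ≤ y ^ m := by
    induction m with
    | zero => simp
    | succ m ih => exact pow_succ y m ▸ Commute.mul_nonneg ih hy (Commute.pow_left rfl m)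
  have : 0 ≤ (Nat.choose n ν) • (x ^ ν * (1 - x) ^ (n - ν)) :=
    nsmul_nonneg (Commute.mul_nonneg (hpow h0 _) (hpow (sub_nonneg.2 h1) _) (hc.pow_pow _ _)) _
  simpa [bernsteinPolynomial, mul_assoc, nsmul_eq_mul] using this

namespace PositiveLinearMap

variable {A B : Type*} [CStarAlgebra A] [PartialOrder A] [StarOrderedRing A]
  [CStarAlgebra B] [PartialOrder B] [StarOrderedRing B]

/-- Kadison's inequality for elements between `0` and `1`. -/
lemma sq_map_le_map_sq_of_nonneg_of_le_one (Φ : A →ₚ[ℂ] B) (hΦ : Φ 1 = 1) {x : A} (h0 : 0 ≤ x)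
    (h1 : x ≤ 1) : Φ x ^ 2 ≤ Φ (x ^ 2) := by
  have hy : IsSelfAdjoint (Φ x) := .of_nonneg (Φ.map_nonneg h0)
  rw [← sub_nonneg]
  refine CStarAlgebra.nonneg_of_forall_smul_add_nonneg (q := Φ x - Φ (x ^ 2)) fun n hn ↦ ?_
  set q : ℕ → B := fun ν ↦ Φ (Polynomial.aeval x (bernsteinPolynomial ℝ n ν))
  have hq0 (ν : ℕ) : 0 ≤ q ν :=
    Φ.map_nonneg (CStarAlgebra.aeval_bernsteinPolynomial_nonneg h0 h1 n ν)
  have hs0 : ∑ ν ∈ Finset.range (n + 1), q ν = 1 := by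
    simpa [hΦ] using congrArg (fun p ↦ Φ (Polynomial.aeval x p)) (bernsteinPolynomial.sum ℝ n)
  have hs1 : ∑ ν ∈ Finset.range (n + 1), (ν : ℝ) • q ν = (n : ℝ) • Φ x := by
    simp only [Nat.cast_smul_eq_nsmul]
    simpa only [map_sum, map_nsmul, Polynomial.aeval_X] using
      congrArg (fun p ↦ Φ (Polynomial.aeval x p)) (bernsteinPolynomial.sum_smul ℝ n)
  have hs2 : ∑ ν ∈ Finset.range (n + 1), ((ν : ℝ) * (ν - 1)) • q ν
      = ((n : ℝ) * (n - 1)) • Φ (x ^ 2) := by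
    have hcast (m : ℕ) : (m : ℝ) * (m - 1) = ((m * (m - 1) : ℕ) : ℝ) := by
      cases m <;> simp
    simp only [hcast, Nat.cast_smul_eq_nsmul]
    simpa only [map_sum, map_nsmul, map_pow, Polynomial.aeval_X] using
      congrArg (fun p ↦ Φ (Polynomial.aeval x p)) (bernsteinPolynomial.sum_mul_smul ℝ n)
  have hpos : 0 ≤ ∑ ν ∈ Finset.range (n + 1),
      ((ν : ℝ) • (1 : B) - (n : ℝ) • Φ x) * q ν * ((ν : ℝ) • (1 : B) - (n : ℝ) • Φ x) :=
    Finset.sum_nonneg fun ν _ ↦ IsSelfAdjoint.conjugate_nonneg (hq0 ν)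
      (((IsSelfAdjoint.all (ν : ℝ)).smul (.one B)).sub ((IsSelfAdjoint.all (n : ℝ)).smul hy))
  have hexp (ν : ℕ) :
      ((ν : ℝ) • (1 : B) - (n : ℝ) • Φ x) * q ν * ((ν : ℝ) • (1 : B) - (n : ℝ) • Φ x)
      = ((ν : ℝ) * (ν - 1)) • q ν + (ν : ℝ) • q ν - (n : ℝ) • (Φ x * ((ν : ℝ) • q ν))
        - (n : ℝ) • (((ν : ℝ) • q ν) * Φ x) + ((n : ℝ) * n) • (Φ x * q ν * Φ x) := by
    simp only [sub_mul, mul_sub, smul_mul_assoc, mul_smul_comm, one_mul, mul_one]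
    module
  simp only [hexp, Finset.sum_add_distrib, Finset.sum_sub_distrib, ← Finset.smul_sum,
    ← Finset.mul_sum, ← Finset.sum_mul, hs0, hs1, hs2, mul_one] at hpos
  have hn' : (0 : ℝ) < n := by exact_mod_cast hn
  have := smul_nonneg (inv_pos.2 hn').le hpos
  convert this using 1
  simp only [smul_mul_assoc, mul_smul_comm, ← sq (Φ x)]
  match_scalars <;> field_simp <;> ring

/-- **Kadison's inequality**. -/
theorem sq_map_le_map_sq (Φ : A →ₚ[ℂ] B) (hΦ : Φ 1 = 1) {x : A} (hx : IsSelfAdjoint x) :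
    Φ x ^ 2 ≤ Φ (x ^ 2) := by
  set c : ℝ := ‖x‖ + 1
  have hc0 : 0 < c := by positivity
  have hxc : x ≤ c • 1 := by
    refine hx.le_algebraMap_norm_self.trans ?_
    rw [← Algebra.algebraMap_eq_smul_one]
    exact algebraMap_mono A (by linarith)
  have hcx : -(c • 1) ≤ x := by
    refine le_trans ?_ hx.neg_algebraMap_norm_le_self
    rw [← Algebra.algebraMap_eq_smul_one, neg_le_neg_iff]
    exact algebraMap_mono A (by linarith)
  set u : A := (2 * c)⁻¹ • (x + c • 1) with hu
  have hu0 : 0 ≤ u := smul_nonneg (by positivity) (neg_le_iff_add_nonneg.1 hcx)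
  have hu1 : u ≤ 1 := by
    have : 0 ≤ (2 * c)⁻¹ • (c • 1 - x) := smul_nonneg (by positivity) (sub_nonneg.2 hxc)
    rw [← sub_nonneg]
    convert this using 1
    rw [hu]
    match_scalars <;> field_simp
    ring
  have hxu : x = (2 * c) • u - c • 1 := by
    rw [hu]
    match_scalars <;> field_simp
    ring
  have key := smul_nonneg (sq_nonneg (2 * c))
    (sub_nonneg.2 (Φ.sq_map_le_map_sq_of_nonneg_of_le_one hΦ hu0 hu1))
  rw [← sub_nonneg]
  convert key using 1
  clear_value u
  simp only [hxu, sq ((2 * c) • u - c • (1 : A)), map_sub, Φ.map_smul_of_tower, hΦ, sub_mul, mul_sub,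
    smul_mul_assoc, mul_smul_comm, one_mul, mul_one, sq (_ - _ : B), ← sq u, ← sq (Φ u)]
  module

/-- Equality in Kadison's inequality at `h` puts `h` in the Jordan multiplicative domain. -/
theorem map_mul_add_mul_of_map_sq_eq (Φ : A →ₚ[ℂ] B) (hΦ : Φ 1 = 1) {h : A}
    (hh : IsSelfAdjoint h) (hsq : Φ (h ^ 2) = Φ h ^ 2) (b : A) :
    Φ (h * b + b * h) = Φ h * Φ b + Φ b * Φ h := by
  have hsa {b : A} (hb : IsSelfAdjoint b) : Φ (h * b + b * h) = Φ h * Φ b + Φ b * Φ h := by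
    have key (t : ℝ) : 0 ≤ t • (Φ (h * b + b * h) - (Φ h * Φ b + Φ b * Φ h))
        + (Φ (b ^ 2) - Φ b ^ 2) := by
      have := sub_nonneg.2 (Φ.sq_map_le_map_sq hΦ (hb.add ((IsSelfAdjoint.all t).smul hh)))
      convert this using 1
      rw [map_add Φ b, sq (b + _), sq (Φ b + _)]
      simp only [add_mul, mul_add, map_add, smul_mul_assoc, mul_smul_comm, Φ.map_smul_of_tower,
        ← sq h, ← sq b, ← sq (Φ h), ← sq (Φ b), hsq]
      module
    rw [← sub_eq_zero]
    refine le_antisymm (neg_nonneg.1 ?_)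
      (CStarAlgebra.nonneg_of_forall_smul_add_nonneg fun n _ ↦ key n)
    exact CStarAlgebra.nonneg_of_forall_smul_add_nonneg fun n _ ↦ by
      simpa only [smul_neg, neg_smul] using key (-n)
  rw [← realPart_add_I_smul_imaginaryPart b]
  have h1 := hsa (realPart b).2
  have h2 := hsa (imaginaryPart b).2
  simp only [map_add, mul_add, add_mul, map_smul, mul_smul_comm, smul_mul_assoc] at h1 h2 ⊢
  linear_combination (norm := module) h1 + Complex.I • h2

/-- If `h` and `h ^ 2` are fixed by `Φ`, then the fixed points of `Φ` commuting with `h` are stable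
under multiplication by `h`. -/
lemma map_mul_eq_of_commute (Φ : A →ₚ[ℂ] A) (hΦ : Φ 1 = 1) {h b : A} (hh : IsSelfAdjoint h)
    (hfix : Φ h = h) (hsq : Φ (h ^ 2) = h ^ 2) (hb : Φ b = b) (hc : Commute b h) :
    Φ (h * b) = h * b := by
  have := Φ.map_mul_add_mul_of_map_sq_eq hΦ hh (by rw [hsq, hfix]) b
  rw [hfix, hb, hc.eq, ← two_smul ℂ (h * b), map_smul] at this
  exact smul_right_injective A (two_ne_zero' ℂ) this

open ComplexStarModule in
/-- If `Φ` fixes a normal element `a` and `star a * a`, then it fixes `C*(1,a)` pointwise. -/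
theorem map_eq_self_of_mem_elemental (Φ : A →ₚ[ℂ] A) (hΦ : Φ 1 = 1) {a : A} [IsStarNormal a]
    (hfix : Φ a = a) (hsq : Φ (star a * a) = star a * a) {b : A}
    (hb : b ∈ StarAlgebra.elemental ℂ a) : Φ b = b := by
  have hre : Φ (ℜ a : A) = ℜ a := by rw [map_realPart, hfix]
  have him : Φ (ℑ a : A) = ℑ a := by rw [map_imaginaryPart, hfix]
  have hre_le := Φ.sq_map_le_map_sq hΦ (ℜ a).2
  have him_le := Φ.sq_map_le_map_sq hΦ (ℑ a).2
  rw [hre] at hre_le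
  rw [him] at him_le
  have hsum : Φ ((ℜ a : A) ^ 2) + Φ ((ℑ a : A) ^ 2) = (ℜ a : A) ^ 2 + (ℑ a : A) ^ 2 := by
    rw [← map_add, sq, sq, ← star_mul_self_eq_realPart_sq_add_imaginaryPart_sq, hsq]
  obtain ⟨hre_sq, him_sq⟩ := (add_eq_add_iff_eq_and_eq hre_le him_le).1 hsum.symm
  have hadjoin {c : A} (hc : c ∈ Algebra.adjoin ℂ ({a} ∪ star {a} : Set A)) :
      ∀ b, Commute b a → Commute b (star a) → Φ b = b →
        Commute (c * b) a ∧ Commute (c * b) (star a) ∧ Φ (c * b) = c * b := by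
    have hmul (b : A) (h1 : Commute b a) (h2 : Commute b (star a)) (h3 : Φ b = b) :
        Φ ((ℜ a : A) * b) = ℜ a * b ∧ Φ ((ℑ a : A) * b) = ℑ a * b := by
      refine ⟨Φ.map_mul_eq_of_commute hΦ (ℜ a).2 hre hre_sq.symm h3 ?_,
        Φ.map_mul_eq_of_commute hΦ (ℑ a).2 him him_sq.symm h3 ?_⟩
      · rw [realPart_apply_coe]
        exact (h1.add_right h2).smul_right _
      · rw [imaginaryPart_apply_coe]
        exact ((h1.sub_right h2).smul_right _).smul_right _
    have hn : Commute (star a) a := star_comm_self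
    induction hc using Algebra.adjoin_induction with
    | mem x hx =>
      intro b h1 h2 h3
      obtain ⟨hr, hi⟩ := hmul b h1 h2 h3
      obtain rfl | hx := hx
      · refine ⟨(Commute.refl x).mul_left h1, hn.symm.mul_left h2, ?_⟩
        conv_lhs => rw [← realPart_add_I_smul_imaginaryPart x]
        rw [add_mul, map_add, smul_mul_assoc, map_smul, hr, hi, ← smul_mul_assoc, ← add_mul,
          realPart_add_I_smul_imaginaryPart]
      · obtain rfl : x = star a := star_eq_iff_star_eq.1 (by simpa using hx) |>.symm
        have hs : star a = (ℜ a : A) - Complex.I • (ℑ a : A) := by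
          conv_lhs => rw [← realPart_add_I_smul_imaginaryPart a]
          simp [sub_eq_add_neg]
        refine ⟨hn.mul_left h1, (Commute.refl _).mul_left h2, ?_⟩
        rw [hs, sub_mul, map_sub, smul_mul_assoc, map_smul, hr, hi]
    | algebraMap r =>
      intro b h1 h2 h3
      rw [← Algebra.smul_def]
      exact ⟨h1.smul_left r, h2.smul_left r, by rw [map_smul, h3]⟩
    | add x y _ _ hx hy =>
      intro b h1 h2 h3
      obtain ⟨hx1, hx2, hx3⟩ := hx b h1 h2 h3
      obtain ⟨hy1, hy2, hy3⟩ := hy b h1 h2 h3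
      rw [add_mul]
      exact ⟨hx1.add_left hy1, hx2.add_left hy2, by rw [map_add, hx3, hy3]⟩
    | mul x y _ _ hx hy =>
      intro b h1 h2 h3
      obtain ⟨hy1, hy2, hy3⟩ := hy b h1 h2 h3
      rw [mul_assoc]
      exact hx _ hy1 hy2 hy3
  refine closure_minimal (t := {b | Φ b = b}) (fun c hc ↦ ?_)
    (isClosed_eq (map_continuous Φ) continuous_id) hb
  simpa using (hadjoin hc 1 (Commute.one_left _) (Commute.one_left _) hΦ).2.2

end PositiveLinearMap

/-- **Corollary 2.4.** Let `A` be a unital C*-algebra, `Φ : A → A` a positive unital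
linear map, and `a ∈ A` a normal element. Then `Φ(a) = a` and `Φ(a*a) = a*a` if and only
if `Φ(b) = b` for every `b` in `C*(1,a)`. -/
theorem propagation_of_fixed_points_normal {A : Type*}
    [NormedRing A] [StarRing A] [CStarRing A] [CompleteSpace A]
    [NormedAlgebra ℂ A] [StarModule ℂ A] [PartialOrder A] [StarOrderedRing A]
    (Φ : A →ₗ[ℂ] A) (hpos : ∀ x : A, 0 ≤ x → 0 ≤ Φ x) (hunital : Φ 1 = 1)
    (a : A) (ha : star a * a = a * star a) :
    (Φ a = a ∧ Φ (star a * a) = star a * a) ↔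
      ∀ b ∈ StarAlgebra.elemental ℂ a, Φ b = b := by
  let _ : CStarAlgebra A := {}
  have : IsStarNormal a := ⟨ha⟩
  refine ⟨fun ⟨h1, h2⟩ b hb ↦
    (PositiveLinearMap.mk₀ Φ hpos).map_eq_self_of_mem_elemental hunital h1 h2 hb, fun h ↦ ?_⟩
  have hself := StarAlgebra.elemental.self_mem ℂ a
  exact ⟨h a hself, h _ (mul_mem (star_mem hself) hself)⟩
end

section
/- Let H be a complex Hilbert space and let (Φ_t)_{t ≥ 0} be a one-parameter semigroup of linear maps Φ_t : B(H) → B(H) such that Φ_0 = id, Φ_{s+t} = Φ_s ∘ Φ_t for all s, t ≥ 0, each Φ_t is unital, completely positive, and continuous with respect to the weak operator topology, and for each a ∈ B(H) the map t ↦ Φ_t(a) is continuous into B(H) with the weak operator topology. Then there exists a unital completely positive linear map Ψ : B(H) → B(H) with Ψ ∘ Ψ = Ψ whose range equals the set of joint fixed points {a ∈ B(H) : Φ_t(a) = a for all t ≥ 0}. -/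
open scoped Matrix InnerProductSpace Topology

/-- A map between star rings is *completely positive* if, for every `n`, applying it
entrywise to `n × n` matrices sends positive elements (i.e. those of the form `Nᴴ * N`)
of the matrix ring over the domain to positive elements of the matrix ring over the
codomain. -/
def CompletelyPositive {A B : Type*} [NonUnitalNonAssocSemiring A] [StarRing A]
    [NonUnitalNonAssocSemiring B] [StarRing B] (Φ : A → B) : Prop :=
  ∀ n : ℕ, ∀ M : Matrix (Fin n) (Fin n) A,
    (∃ N : Matrix (Fin n) (Fin n) A, M = Nᴴ * N) →
      ∃ P : Matrix (Fin n) (Fin n) B, M.map Φ = Pᴴ * P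

/-- The weak operator topology on `B(H)`: the topology of pointwise convergence of the
scalar pairings `T ↦ ⟪T x, y⟫` for `x y : H`. -/
noncomputable def wot (H : Type*) [NormedAddCommGroup H] [InnerProductSpace ℂ H] :
    TopologicalSpace (H →L[ℂ] H) :=
  TopologicalSpace.induced
    (fun T : H →L[ℂ] H => fun p : H × H => (⟪T p.1, p.2⟫_ℂ)) inferInstance

open Filter
open scoped ComplexOrder

section WeakOperatorLimits

variable {H : Type*} [NormedAddCommGroup H] [InnerProductSpace ℂ H]

lemma tendsto_nhds_wot_iff {ι : Type*} {l : Filter ι} {f : ι → H →L[ℂ] H} {b : H →L[ℂ] H} :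
    Tendsto f l (@nhds _ (wot H) b) ↔
      ∀ x y, Tendsto (fun i => ⟪f i x, y⟫_ℂ) l (𝓝 ⟪b x, y⟫_ℂ) := by
  rw [wot, nhds_induced, tendsto_comap_iff, tendsto_pi_nhds]
  exact Prod.forall

lemma eq_of_tendsto_nhds_wot {ι : Type*} {l : Filter ι} [l.NeBot] {f : ι → H →L[ℂ] H}
    {b c : H →L[ℂ] H} (hb : Tendsto f l (@nhds _ (wot H) b))
    (hc : Tendsto f l (@nhds _ (wot H) c)) : b = c := by
  rw [tendsto_nhds_wot_iff] at hb hc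
  ext x
  exact ext_inner_right ℂ fun y => tendsto_nhds_unique (hb x y) (hc x y)

lemma norm_sum_range_shift_sub_le {E : Type*} [SeminormedAddCommGroup E] {g : ℕ → E} {C : ℝ}
    (hg : ∀ k, ‖g k‖ ≤ C) (m N : ℕ) :
    ‖∑ k ∈ Finset.range N, g (m + k) - ∑ k ∈ Finset.range N, g k‖ ≤ 2 * m * C := by
  have h : ∑ k ∈ Finset.range N, g (m + k) - ∑ k ∈ Finset.range N, g k =
      ∑ k ∈ Finset.range m, g (N + k) - ∑ k ∈ Finset.range m, g k := by
    have h₁ := Finset.sum_range_add g m N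
    have h₂ := Finset.sum_range_add g N m
    rw [add_comm N m, h₁] at h₂
    rw [sub_eq_sub_iff_add_eq_add, add_comm, h₂, add_comm]
  rw [h]
  calc _ ≤ _ := norm_sub_le _ _
    _ ≤ ∑ _k ∈ Finset.range m, C + ∑ _k ∈ Finset.range m, C :=
      add_le_add (norm_sum_le_of_le _ fun k _ => hg _) (norm_sum_le_of_le _ fun k _ => hg _)
    _ = 2 * m * C := by simp; ring

lemma tendsto_nhds_wot_of_norm_sub_tendsto_zero {ι : Type*} {l : Filter ι}
    {f g : ι → H →L[ℂ] H} {b : H →L[ℂ] H} (hf : Tendsto f l (@nhds _ (wot H) b))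
    (h : Tendsto (fun i => ‖g i - f i‖) l (𝓝 0)) : Tendsto g l (@nhds _ (wot H) b) := by
  rw [tendsto_nhds_wot_iff] at hf ⊢
  intro x y
  have h0 : Tendsto (fun i => ⟪(g i - f i) x, y⟫_ℂ) l (𝓝 ⟪(0 : H →L[ℂ] H) x, y⟫_ℂ) :=
    (((ContinuousLinearMap.apply ℂ H x).continuous.tendsto 0).comp
      (tendsto_zero_iff_norm_tendsto_zero.2 h)).inner tendsto_const_nhds
  simpa [inner_sub_left] using (hf x y).add h0

/-- The average of a family of maps on `B(H)` over the first `4 ^ n` multiples of `2⁻ⁿ`. -/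
noncomputable def dyadicAverage (Φ : ℝ → ((H →L[ℂ] H) →ₗ[ℂ] (H →L[ℂ] H))) (n : ℕ) :
    (H →L[ℂ] H) →ₗ[ℂ] (H →L[ℂ] H) :=
  ((4 : ℂ) ^ n)⁻¹ • ∑ k ∈ Finset.range (4 ^ n), Φ (k / 2 ^ n)

lemma dyadicAverage_apply_of_fixed {Φ : ℝ → ((H →L[ℂ] H) →ₗ[ℂ] (H →L[ℂ] H))} {a : H →L[ℂ] H}
    (ha : ∀ t, 0 ≤ t → Φ t a = a) (n : ℕ) : dyadicAverage Φ n a = a := by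
  have h (k : ℕ) : Φ (k / 2 ^ n) a = a := ha _ (by positivity)
  simp [dyadicAverage, LinearMap.sum_apply, h, ← Nat.cast_smul_eq_nsmul ℂ]

lemma tendsto_norm_apply_dyadicAverage_sub {Φ : ℝ → ((H →L[ℂ] H) →ₗ[ℂ] (H →L[ℂ] H))} {C : ℝ}
    (hsemi : ∀ s t : ℝ, 0 ≤ s → 0 ≤ t → Φ (s + t) = (Φ s).comp (Φ t))
    {a : H →L[ℂ] H} (hC : ∀ t, 0 ≤ t → ‖Φ t a‖ ≤ C) (p q : ℕ) :
    Tendsto (fun n => ‖Φ (p / 2 ^ q) (dyadicAverage Φ n a) - dyadicAverage Φ n a‖)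
      atTop (𝓝 0) := by
  have hC0 : 0 ≤ C := (norm_nonneg _).trans (hC 0 le_rfl)
  have hlim : Tendsto (fun n : ℕ => 2 * p * C * (1 / 2 : ℝ) ^ n) atTop (𝓝 0) := by
    simpa using (tendsto_pow_atTop_nhds_zero_of_lt_one (r := (1 / 2 : ℝ)) (by norm_num)
      (by norm_num)).const_mul (2 * p * C)
  refine squeeze_zero' (.of_forall fun _ => norm_nonneg _) ?_ hlim
  filter_upwards [eventually_ge_atTop q] with n hn
  obtain ⟨r, rfl⟩ := Nat.exists_eq_add_of_le hn
  have hshift (k : ℕ) : Φ (p / 2 ^ q) (Φ (k / 2 ^ (q + r)) a) =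
      Φ ((p * 2 ^ r + k : ℕ) / 2 ^ (q + r)) a := by
    rw [← LinearMap.comp_apply, ← hsemi _ _ (by positivity) (by positivity)]
    congr 2
    push_cast
    field_simp
    ring
  have h := norm_sum_range_shift_sub_le (g := fun k : ℕ => Φ (k / 2 ^ (q + r)) a)
    (fun k => hC _ (by positivity)) (p * 2 ^ r) (4 ^ (q + r))
  have heq : Φ (p / 2 ^ q) (dyadicAverage Φ (q + r) a) - dyadicAverage Φ (q + r) a =
      ((4 : ℂ) ^ (q + r))⁻¹ •
        (∑ k ∈ Finset.range (4 ^ (q + r)), Φ ((p * 2 ^ r + k : ℕ) / 2 ^ (q + r)) a -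
          ∑ k ∈ Finset.range (4 ^ (q + r)), Φ (k / 2 ^ (q + r)) a) := by
    simp only [dyadicAverage, LinearMap.smul_apply, LinearMap.sum_apply, map_smul, map_sum,
      hshift, smul_sub]
  rw [heq, norm_smul]
  calc _ ≤ ‖((4 : ℂ) ^ (q + r))⁻¹‖ * (2 * (p * 2 ^ r : ℕ) * C) := by gcongr
    _ = (4 ^ (q + r) : ℝ)⁻¹ * (2 * (p * 2 ^ r) * C) := by simp
    _ ≤ (4 ^ (q + r) : ℝ)⁻¹ * (2 * (p * 2 ^ (q + r)) * C) := by
      gcongr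
      · norm_num
      · omega
    _ = 2 * p * C * (1 / 2 : ℝ) ^ (q + r) := by
      rw [show (4 : ℝ) = 2 * 2 by norm_num, mul_pow, one_div, inv_pow]
      field_simp

lemma apply_eq_of_forall_dyadic {Φ : ℝ → ((H →L[ℂ] H) →ₗ[ℂ] (H →L[ℂ] H))} {b : H →L[ℂ] H}
    (htraj : @ContinuousOn ℝ (H →L[ℂ] H) _ (wot H) (fun t => Φ t b) (Set.Ici 0))
    (hb : ∀ p q : ℕ, Φ (p / 2 ^ q) b = b) {t : ℝ} (ht : 0 ≤ t) : Φ t b = b := by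
  have hlim : Tendsto (fun n : ℕ => (⌊t * 2 ^ n⌋₊ : ℝ) / 2 ^ n) atTop (𝓝[Set.Ici 0] t) :=
    tendsto_nhdsWithin_iff.2 ⟨(tendsto_nat_floor_mul_div_atTop ht).comp
      (tendsto_pow_atTop_atTop_of_one_lt one_lt_two), .of_forall fun n => by
        simp only [Set.mem_Ici]; positivity⟩
  have h := Tendsto.comp (htraj t ht) hlim
  refine eq_of_tendsto_nhds_wot h ?_
  simp only [Function.comp_def, hb]
  exact @tendsto_const_nhds _ (wot H) _ _ _

variable [CompleteSpace H]

/-- Closed balls of `B(H)` are compact in the weak operator topology. -/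
lemma exists_tendsto_nhds_wot_of_bounded {ι : Type*} (U : Ultrafilter ι) {f : ι → H →L[ℂ] H}
    {C : ℝ} (hf : ∀ i, ‖f i‖ ≤ C) : ∃ b, Tendsto f U (@nhds _ (wot H) b) := by
  have bound (x y : H) (i : ι) : ‖⟪f i x, y⟫_ℂ‖ ≤ C * ‖x‖ * ‖y‖ :=
    (norm_inner_le_norm _ _).trans <| by
      gcongr
      exact (f i).le_of_opNorm_le (hf i) x
  have key (x y : H) : ∃ z, Tendsto (fun i => ⟪f i x, y⟫_ℂ) U (𝓝 z) := by
    obtain ⟨z, -, hz⟩ := (isCompact_closedBall (0 : ℂ) (C * ‖x‖ * ‖y‖)).ultrafilter_le_nhds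
      (U.map fun i => ⟪f i x, y⟫_ℂ) (by
        rw [le_principal_iff]
        exact Filter.Eventually.of_forall (f := (U : Filter ι)) fun i => by
          simpa using bound x y i)
    exact ⟨z, hz⟩
  choose L hL using key
  let B : H →L⋆[ℂ] H →L[ℂ] ℂ := LinearMap.mkContinuous₂
    (LinearMap.mk₂'ₛₗ (starRingEnd ℂ) (RingHom.id ℂ) L
      (fun x₁ x₂ y => tendsto_nhds_unique (hL _ _) (by
        simpa [inner_add_left] using (hL x₁ y).add (hL x₂ y)))
      (fun c x y => tendsto_nhds_unique (hL _ _) (by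
        simpa [inner_smul_left, mul_comm] using (hL x y).const_mul (starRingEnd ℂ c)))
      (fun x y₁ y₂ => tendsto_nhds_unique (hL _ _) (by
        simpa [inner_add_right] using (hL x y₁).add (hL x y₂)))
      (fun c x y => tendsto_nhds_unique (hL _ _) (by
        simpa [inner_smul_right] using (hL x y).const_mul c)))
    C (fun x y => le_of_tendsto (hL x y).norm (Filter.Eventually.of_forall (bound x y)))
  refine ⟨InnerProductSpace.continuousLinearMapOfBilin B, ?_⟩
  rw [tendsto_nhds_wot_iff]
  intro x y
  rw [InnerProductSpace.continuousLinearMapOfBilin_apply]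
  exact hL x y

/-- A uniformly bounded family of linear maps on `B(H)` has a pointwise limit along every
ultrafilter, for the weak operator topology. -/
lemma exists_linearMap_tendsto_nhds_wot {ι : Type*} (U : Ultrafilter ι)
    {T : ι → (H →L[ℂ] H) →ₗ[ℂ] (H →L[ℂ] H)} {C : ℝ} (hT : ∀ i a, ‖T i a‖ ≤ C * ‖a‖) :
    ∃ Ψ : (H →L[ℂ] H) →ₗ[ℂ] (H →L[ℂ] H),
      ∀ a, Tendsto (fun i => T i a) U (@nhds _ (wot H) (Ψ a)) := by
  choose Ψ hΨ using fun a => exists_tendsto_nhds_wot_of_bounded U fun i => hT i a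
  refine ⟨{ toFun := Ψ, map_add' := fun a b => ?_, map_smul' := fun c a => ?_ }, hΨ⟩
  · refine eq_of_tendsto_nhds_wot (hΨ (a + b)) ?_
    simp only [tendsto_nhds_wot_iff] at hΨ ⊢
    intro x y
    simpa [inner_add_left] using (hΨ a x y).add (hΨ b x y)
  · refine eq_of_tendsto_nhds_wot (hΨ (c • a)) ?_
    simp only [tendsto_nhds_wot_iff] at hΨ ⊢
    intro x y
    simpa [inner_smul_left, mul_comm] using (hΨ a x y).const_mul (starRingEnd ℂ c)

lemma ContinuousLinearMap.IsPositive.exists_eq_adjoint_mul_self {T : H →L[ℂ] H}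
    (hT : T.IsPositive) : ∃ S : H →L[ℂ] H, T = star S * S :=
  CStarAlgebra.nonneg_iff_eq_star_mul_self.1 ((nonneg_iff_isPositive T).2 hT)

/-- The operator on the Hilbert sum `H ⊕ ⋯ ⊕ H` given by a matrix of operators. -/
noncomputable def Matrix.toPiLpCLM {n : ℕ} (M : Matrix (Fin n) (Fin n) (H →L[ℂ] H)) :
    PiLp 2 (fun _ : Fin n => H) →L[ℂ] PiLp 2 (fun _ : Fin n => H) :=
  ∑ i, ∑ j, (PiLp.proj 2 (𝕜 := ℂ) (fun _ : Fin n => H) i).adjoint ∘L M i j ∘L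
    PiLp.proj 2 (𝕜 := ℂ) (fun _ : Fin n => H) j

lemma PiLp.proj_comp_adjoint_proj {n : ℕ} (i j : Fin n) :
    PiLp.proj 2 (𝕜 := ℂ) (fun _ : Fin n => H) i ∘L
      (PiLp.proj 2 (𝕜 := ℂ) (fun _ : Fin n => H) j).adjoint = if i = j then 1 else 0 := by
  have h (v : H) : (PiLp.proj 2 (𝕜 := ℂ) (fun _ : Fin n => H) j).adjoint v =
      WithLp.toLp 2 (Pi.single j v) := by
    refine ext_inner_right ℂ fun w => ?_
    rw [ContinuousLinearMap.adjoint_inner_left, PiLp.inner_apply,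
      Finset.sum_eq_single j (by intro b _ hb; simp [hb]) (by simp)]
    simp
  ext v
  by_cases hij : i = j <;> simp [h, hij]

lemma PiLp.sum_adjoint_proj_comp_proj {n : ℕ} :
    ∑ k, (PiLp.proj 2 (𝕜 := ℂ) (fun _ : Fin n => H) k).adjoint ∘L
      PiLp.proj 2 (𝕜 := ℂ) (fun _ : Fin n => H) k = 1 := by
  ext1 v
  refine ext_inner_right ℂ fun w => ?_
  simp [sum_inner, ContinuousLinearMap.adjoint_inner_left, PiLp.inner_apply]

lemma Matrix.inner_toPiLpCLM {n : ℕ} (M : Matrix (Fin n) (Fin n) (H →L[ℂ] H))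
    (x : PiLp 2 fun _ : Fin n => H) :
    ⟪M.toPiLpCLM x, x⟫_ℂ = ∑ i, ∑ j, ⟪M i j (x j), x i⟫_ℂ := by
  simp [toPiLpCLM, ContinuousLinearMap.adjoint_inner_left]

lemma Matrix.proj_toPiLpCLM_adjoint_proj {n : ℕ} (M : Matrix (Fin n) (Fin n) (H →L[ℂ] H))
    (i j : Fin n) :
    PiLp.proj 2 (𝕜 := ℂ) (fun _ : Fin n => H) i ∘L M.toPiLpCLM ∘L
      (PiLp.proj 2 (𝕜 := ℂ) (fun _ : Fin n => H) j).adjoint = M i j := by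
  have h (k l : Fin n) (v : H) : PiLp.proj 2 (𝕜 := ℂ) (fun _ : Fin n => H) k
      ((PiLp.proj 2 (𝕜 := ℂ) (fun _ : Fin n => H) l).adjoint v) = if k = l then v else 0 := by
    have := DFunLike.congr_fun (PiLp.proj_comp_adjoint_proj (H := H) k l) v
    split_ifs at this ⊢ <;> simpa using this
  ext v
  simp only [toPiLpCLM, ContinuousLinearMap.comp_apply, _root_.sum_apply, map_sum, h]
  rw [Finset.sum_eq_single i (by intro b _ hb; simp [hb.symm]) (by simp),
    Finset.sum_eq_single j (by intro b _ hb; simp [hb]) (by simp)]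
  simp

/-- A matrix of operators is of the form `Nᴴ * N` iff its quadratic form is nonnegative. -/
lemma Matrix.exists_eq_conjTranspose_mul_self_iff {n : ℕ}
    (M : Matrix (Fin n) (Fin n) (H →L[ℂ] H)) :
    (∃ N : Matrix (Fin n) (Fin n) (H →L[ℂ] H), M = Nᴴ * N) ↔
      ∀ x : Fin n → H, 0 ≤ ∑ i, ∑ j, ⟪M i j (x j), x i⟫_ℂ := by
  constructor
  · rintro ⟨N, rfl⟩ x
    have : ∑ i, ∑ j, ⟪(Nᴴ * N) i j (x j), x i⟫_ℂ =
        ∑ k, ⟪∑ j, N k j (x j), ∑ i, N k i (x i)⟫_ℂ := by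
      simp only [Matrix.mul_apply, Matrix.conjTranspose_apply, _root_.sum_apply,
        mul_apply_eq_comp, sum_inner, inner_sum, ContinuousLinearMap.star_eq_adjoint,
        ContinuousLinearMap.adjoint_inner_left]
      rw [Finset.sum_congr rfl fun i _ => Finset.sum_comm, Finset.sum_comm]
    rw [this]
    exact Finset.sum_nonneg fun k _ =>
      Complex.nonneg_iff.2 ⟨inner_self_nonneg (𝕜 := ℂ), (inner_self_im (𝕜 := ℂ) _).symm⟩
  · intro h
    have hpos : M.toPiLpCLM.IsPositive := by
      rw [ContinuousLinearMap.isPositive_iff_complex]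
      intro x
      rw [M.inner_toPiLpCLM x]
      have := Complex.nonneg_iff.1 (h x)
      exact ⟨Complex.ext rfl (by simpa using this.2), this.1⟩
    obtain ⟨S, hS⟩ := hpos.exists_eq_adjoint_mul_self
    refine ⟨.of fun k j => PiLp.proj 2 (𝕜 := ℂ) (fun _ : Fin n => H) k ∘L S ∘L
      (PiLp.proj 2 (𝕜 := ℂ) (fun _ : Fin n => H) j).adjoint, ?_⟩
    ext1 i j
    rw [← M.proj_toPiLpCLM_adjoint_proj i j, hS, Matrix.mul_apply]
    ext v
    have hsum := DFunLike.congr_fun (PiLp.sum_adjoint_proj_comp_proj (H := H) (n := n))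
      (S ((PiLp.proj 2 (𝕜 := ℂ) (fun _ : Fin n => H) j).adjoint v))
    simp only [_root_.sum_apply, ContinuousLinearMap.comp_apply,
      one_apply_eq_self] at hsum
    simp only [ContinuousLinearMap.comp_apply, mul_apply_eq_comp,
      Matrix.conjTranspose_apply, Matrix.of_apply, ContinuousLinearMap.star_eq_adjoint,
      ContinuousLinearMap.adjoint_comp, ContinuousLinearMap.adjoint_adjoint,
      _root_.sum_apply]
    rw [← map_sum, ← map_sum, hsum]

lemma CompletelyPositive.nonneg_of_nonneg {Φ : (H →L[ℂ] H) → (H →L[ℂ] H)}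
    (hΦ : CompletelyPositive Φ) {a : H →L[ℂ] H} (ha : 0 ≤ a) : 0 ≤ Φ a := by
  obtain ⟨s, hs⟩ := ((ContinuousLinearMap.nonneg_iff_isPositive a).1 ha).exists_eq_adjoint_mul_self
  obtain ⟨P, hP⟩ := hΦ 1 (.of fun _ _ => a) ⟨.of fun _ _ => s, by ext1; simp [Matrix.mul_apply, hs]⟩
  have := congr_fun₂ hP 0 0
  simp only [Matrix.map_apply, Matrix.of_apply, Matrix.mul_apply, Finset.univ_unique,
    Finset.sum_singleton, Matrix.conjTranspose_apply] at this
  rw [this]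
  exact star_mul_self_nonneg _

lemma CompletelyPositive.norm_apply_le {Φ : (H →L[ℂ] H) →ₗ[ℂ] (H →L[ℂ] H)}
    (hΦ : CompletelyPositive Φ) (h1 : Φ 1 = 1) (a : H →L[ℂ] H) : ‖Φ a‖ ≤ 4 * ‖a‖ := by
  let f : (H →L[ℂ] H) →ₚ[ℂ] (H →L[ℂ] H) := .mk₀ Φ fun _ h => hΦ.nonneg_of_nonneg h
  have hf (x : H →L[ℂ] H) (hx : 0 ≤ x) : ‖Φ x‖ ≤ ‖x‖ :=
    calc ‖Φ x‖ ≤ ‖Φ 1‖ * ‖x‖ := f.norm_apply_le_of_nonneg x hx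
      _ ≤ 1 * ‖x‖ := by
        rw [h1]
        gcongr
        exact ContinuousLinearMap.norm_id_le
      _ = ‖x‖ := one_mul _
  obtain ⟨y, hy0, hyn, hy⟩ := CStarAlgebra.exists_sum_four_nonneg a
  conv_lhs => rw [hy, map_sum]
  calc ‖∑ i : Fin 4, Φ (Complex.I ^ (i : ℕ) • y i)‖ ≤ ∑ i : Fin 4, ‖a‖ :=
      norm_sum_le_of_le _ fun i _ => by
        simpa [norm_smul] using (hf _ (hy0 i)).trans (hyn i)
    _ = 4 * ‖a‖ := by simp

lemma CompletelyPositive.sum {ι : Type*} (s : Finset ι)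
    {T : ι → (H →L[ℂ] H) →ₗ[ℂ] (H →L[ℂ] H)} (hT : ∀ i ∈ s, CompletelyPositive (T i)) :
    CompletelyPositive (∑ i ∈ s, T i : (H →L[ℂ] H) →ₗ[ℂ] (H →L[ℂ] H)) := by
  intro n M hM
  rw [Matrix.exists_eq_conjTranspose_mul_self_iff]
  intro x
  have : ∑ i, ∑ j, ⟪M.map (∑ k ∈ s, T k : (H →L[ℂ] H) →ₗ[ℂ] (H →L[ℂ] H)) i j (x j), x i⟫_ℂ =
      ∑ k ∈ s, ∑ i, ∑ j, ⟪M.map (T k) i j (x j), x i⟫_ℂ := by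
    simp only [Matrix.map_apply, LinearMap.sum_apply, _root_.sum_apply, sum_inner]
    rw [Finset.sum_congr rfl fun i _ => Finset.sum_comm, Finset.sum_comm]
  rw [this]
  exact Finset.sum_nonneg fun k hk =>
    (Matrix.exists_eq_conjTranspose_mul_self_iff _).1 (hT k hk n M hM) x

lemma CompletelyPositive.smul {T : (H →L[ℂ] H) →ₗ[ℂ] (H →L[ℂ] H)} (hT : CompletelyPositive T)
    {c : ℂ} (hc : 0 ≤ c) :
    CompletelyPositive (c • T : (H →L[ℂ] H) →ₗ[ℂ] (H →L[ℂ] H)) := by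
  intro n M hM
  rw [Matrix.exists_eq_conjTranspose_mul_self_iff]
  intro x
  have hc' : starRingEnd ℂ c = c := by simpa using (IsSelfAdjoint.of_nonneg hc).star_eq
  have := mul_nonneg hc ((Matrix.exists_eq_conjTranspose_mul_self_iff _).1 (hT n M hM) x)
  simpa [Finset.mul_sum, inner_smul_left, hc', mul_comm] using this

lemma CompletelyPositive.of_tendsto {ι : Type*} {l : Filter ι} [l.NeBot]
    {T : ι → (H →L[ℂ] H) →ₗ[ℂ] (H →L[ℂ] H)} {Ψ : (H →L[ℂ] H) →ₗ[ℂ] (H →L[ℂ] H)}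
    (hT : ∀ i, CompletelyPositive (T i))
    (hΨ : ∀ a, Tendsto (fun i => T i a) l (@nhds _ (wot H) (Ψ a))) :
    CompletelyPositive Ψ := by
  intro n M hM
  rw [Matrix.exists_eq_conjTranspose_mul_self_iff]
  intro x
  simp only [tendsto_nhds_wot_iff] at hΨ
  refine ge_of_tendsto' (tendsto_finsetSum _ fun i _ => tendsto_finsetSum _ fun j _ =>
    hΨ (M i j) (x j) (x i)) fun k => ?_
  exact (Matrix.exists_eq_conjTranspose_mul_self_iff _).1 (hT k n M hM) x

lemma completelyPositive_dyadicAverage {Φ : ℝ → ((H →L[ℂ] H) →ₗ[ℂ] (H →L[ℂ] H))}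
    (hcp : ∀ t, 0 ≤ t → CompletelyPositive (Φ t)) (n : ℕ) :
    CompletelyPositive (dyadicAverage Φ n) :=
  (CompletelyPositive.sum _ fun k _ => hcp _ (by positivity)).smul
    (by rw [inv_nonneg]; exact_mod_cast Nat.zero_le _)

end WeakOperatorLimits

/-- **Ergodic theorem for semigroups of quantum Markov maps (Theorem 2.8.(a)).**
For a weak-operator-topology continuous one-parameter semigroup `(Φ_t)_{t ≥ 0}` of
unital, completely positive, WOT-continuous linear maps on `B(H)`, there is a unital
completely positive idempotent linear map `Ψ` on `B(H)` whose range is exactly the set of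
joint fixed points of the semigroup. -/
theorem exists_idempotent_cp_onto_fixed_points {H : Type*}
    [NormedAddCommGroup H] [InnerProductSpace ℂ H] [CompleteSpace H]
    (Φ : ℝ → ((H →L[ℂ] H) →ₗ[ℂ] (H →L[ℂ] H)))
    (h0 : Φ 0 = LinearMap.id)
    (hsemi : ∀ s t : ℝ, 0 ≤ s → 0 ≤ t → Φ (s + t) = (Φ s).comp (Φ t))
    (hunital : ∀ t : ℝ, 0 ≤ t → Φ t 1 = 1)
    (hcp : ∀ t : ℝ, 0 ≤ t → CompletelyPositive (⇑(Φ t)))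
    (hwcont : ∀ t : ℝ, 0 ≤ t → Continuous[wot H, wot H] (⇑(Φ t)))
    (htraj : ∀ a : H →L[ℂ] H,
      @ContinuousOn ℝ (H →L[ℂ] H) _ (wot H) (fun t => Φ t a) (Set.Ici 0)) :
    ∃ Ψ : (H →L[ℂ] H) →ₗ[ℂ] (H →L[ℂ] H),
      Ψ 1 = 1 ∧ CompletelyPositive (⇑Ψ) ∧ Ψ.comp Ψ = Ψ ∧
        Set.range Ψ = {a : H →L[ℂ] H | ∀ t : ℝ, 0 ≤ t → Φ t a = a} := by
  let U : Ultrafilter ℕ := .of atTop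
  have hU : (U : Filter ℕ) ≤ atTop := Ultrafilter.of_le _
  have hA := completelyPositive_dyadicAverage hcp
  obtain ⟨Ψ, hΨ⟩ := exists_linearMap_tendsto_nhds_wot U fun n =>
    (hA n).norm_apply_le (dyadicAverage_apply_of_fixed hunital n)
  have hfix {a : H →L[ℂ] H} (ha : ∀ t, 0 ≤ t → Φ t a = a) : Ψ a = a := by
    refine eq_of_tendsto_nhds_wot (hΨ a) ?_
    simp only [dyadicAverage_apply_of_fixed ha]
    exact @tendsto_const_nhds _ (wot H) _ _ _
  have hrange (a : H →L[ℂ] H) (t : ℝ) (ht : 0 ≤ t) : Φ t (Ψ a) = Ψ a := by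
    refine apply_eq_of_forall_dyadic (htraj (Ψ a)) (fun p q => ?_) ht
    refine eq_of_tendsto_nhds_wot (Tendsto.comp (@Continuous.tendsto _ _ (wot H) (wot H) _
      (hwcont (p / 2 ^ q) (by positivity)) (Ψ a)) (hΨ a)) ?_
    exact tendsto_nhds_wot_of_norm_sub_tendsto_zero (hΨ a)
      ((tendsto_norm_apply_dyadicAverage_sub hsemi
        (fun t ht => (hcp t ht).norm_apply_le (hunital t ht) a) p q).mono_left hU)
  refine ⟨Ψ, hfix hunital, .of_tendsto hA hΨ, LinearMap.ext fun a => hfix (hrange a),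
    Set.Subset.antisymm ?_ fun a ha => ⟨a, hfix ha⟩⟩
  rintro _ ⟨a, rfl⟩
  exact hrange a
end

section
/- Let H be a complex Hilbert space and let Φ : B(H) → B(H) be a positive unital linear map (for instance the dual, in the Heisenberg picture, of a stochastic map on the trace class). If E ∈ B(H) is an orthogonal projection (E = E* and E ∘ E = E) with Φ(E) = E, then for every S ∈ B(H) one has E ∘ Φ(E ∘ S ∘ E) = Φ(E ∘ S ∘ E) ∘ E = Φ(E ∘ S ∘ E). -/
/-- A positive map on `B(H)` fixing a star projection `e` sends compressions of positive
contractions to elements absorbed by `e` on both sides. -/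
theorem IsStarProjection.absorb_map_compression_of_nonneg {H : Type*}
    [NormedAddCommGroup H] [InnerProductSpace ℂ H] [CompleteSpace H]
    {f : (H →L[ℂ] H) →ₗ[ℂ] (H →L[ℂ] H)} (hf : ∀ T, 0 ≤ T → 0 ≤ f T)
    {e : H →L[ℂ] H} (he : IsStarProjection e) (hfe : f e = e)
    {a : H →L[ℂ] H} (ha : 0 ≤ a) (ha1 : ‖a‖ ≤ 1) :
    f (e * a * e) * e = f (e * a * e) ∧ e * f (e * a * e) = f (e * a * e) := by
  have hnonneg : 0 ≤ e * a * e := he.isSelfAdjoint.conjugate_nonneg ha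
  have hle : e * a * e ≤ e := by
    have h := he.isSelfAdjoint.conjugate_le_conjugate
      (CStarAlgebra.norm_le_one_iff_of_nonneg a ha |>.mp ha1)
    rwa [mul_one, he.isIdempotentElem.eq] at h
  refine he.mul_right_and_mul_left_of_nonneg_of_le (hf _ hnonneg) ?_
  have h := hf _ (sub_nonneg.mpr hle)
  rwa [map_sub, hfe, sub_nonneg] at h


/-- **Lemma 3.4.(ii).** Let `Φ : B(H) → B(H)` be a positive unital linear map and let `E`
be an orthogonal projection with `Φ(E) = E`. Then for every `S ∈ B(H)` one has
`E ∘ Φ(E S E) = Φ(E S E) ∘ E = Φ(E S E)`. -/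
theorem proj_fixed_compression {H : Type*}
    [NormedAddCommGroup H] [InnerProductSpace ℂ H] [CompleteSpace H]
    (Φ : (H →L[ℂ] H) →ₗ[ℂ] (H →L[ℂ] H))
    (hpos : ∀ T : H →L[ℂ] H, T.IsPositive → (Φ T).IsPositive)
    (hunital : Φ 1 = 1)
    (E : H →L[ℂ] H) (hE : IsSelfAdjoint E) (hE2 : E ∘L E = E) (hEfix : Φ E = E)
    (S : H →L[ℂ] H) :
    E ∘L Φ (E ∘L S ∘L E) = Φ (E ∘L S ∘L E) ∧
      Φ (E ∘L S ∘L E) ∘L E = Φ (E ∘L S ∘L E) := by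
  have he : IsStarProjection E := ⟨hE2, hE⟩
  have hf : ∀ T, 0 ≤ T → 0 ≤ Φ T := fun T hT ↦
    (Φ T).nonneg_iff_isPositive.mpr (hpos T (T.nonneg_iff_isPositive.mp hT))
  change E * Φ (E * (S * E)) = Φ (E * (S * E)) ∧ Φ (E * (S * E)) * E = Φ (E * (S * E))
  rw [← mul_assoc]
  have hS : S ∈ Submodule.span ℂ ({x : H →L[ℂ] H | 0 ≤ x} ∩ Metric.closedBall 0 1) := by
    rw [CStarAlgebra.span_nonneg_inter_unitClosedBall]
    trivial
  induction hS using Submodule.span_induction with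
  | mem a ha =>
    exact (he.absorb_map_compression_of_nonneg hf hEfix ha.1
      (mem_closedBall_zero_iff.mp ha.2)).symm
  | zero => simp
  | add x y _ _ hx hy => simp only [mul_add, add_mul, map_add, hx, hy, and_self]
  | smul c x _ hx => simp only [mul_smul_comm, smul_mul_assoc, map_smul, hx, and_self]
end
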